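/- There exists a subset 𝒮′ of the standard Sierpiński carpet 𝒮 such that 𝒮′ is homeomorphic to 𝒮 and 𝒮′ is disjoint from the frontier (taken in ℝ²) of every connected component of ℝ² ∖ 𝒮; that is, the Sierpiński carpet contains an embedded Sierpiński carpet disjoint from all of its peripheral circles. (Paper's Lemma 7.2.) -/

import Mathlib

open Filter Topology Set

noncomputable section

/-- The group of self-homeomorphisms of a topological space, with `(f * g) x = f (g x)`. -/
instance homeomorphGroup {X : Type*} [TopologicalSpace X] : Group (X ≃ₜ X) where
  mul f g := g.trans f
  one := Homeomorph.refl X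
  inv := Homeomorph.symm
  mul_assoc _ _ _ := Homeomorph.ext fun _ => rfl
  one_mul _ := Homeomorph.ext fun _ => rfl
  mul_one _ := Homeomorph.ext fun _ => rfl
  inv_mul_cancel f := Homeomorph.ext fun x => f.symm_apply_apply x

@[simp] theorem homeomorph_mul_apply {X : Type*} [TopologicalSpace X]
    (f g : X ≃ₜ X) (x : X) : (f * g) x = f (g x) := rfl

@[simp] theorem homeomorph_one_apply {X : Type*} [TopologicalSpace X]
    (x : X) : (1 : X ≃ₜ X) x = x := rfl

/-- The Riemann sphere as a topological space: the one-point compactification of `ℂ`. -/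
abbrev S2 : Type := OnePoint ℂ

/-- `f i → ξ` uniformly on compact subsets of the complement of `ζ`. -/
def ConvTo {X : Type*} [TopologicalSpace X] (f : ℕ → X → X) (ζ ξ : X) : Prop :=
  ∀ K : Set X, IsCompact K → ζ ∉ K →
    ∀ U ∈ nhds ξ, ∀ᶠ i in Filter.atTop, ∀ x ∈ K, f i x ∈ U

variable {G : Type*} [Group G] {X : Type*} [TopologicalSpace X]

/-- A convergence group action. -/
def IsConvergenceAction (ρ : G →* (X ≃ₜ X)) : Prop :=
  ∀ g : ℕ → G, Function.Injective g →
    ∃ n : ℕ → ℕ, StrictMono n ∧ ∃ ζ ξ : X,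
      ConvTo (fun i x => ρ (g (n i)) x) ζ ξ

/-- The limit set of an action. -/
def limitSet (ρ : G →* (X ≃ₜ X)) : Set X :=
  {ξ | ∃ (g : ℕ → G) (y : X), Function.Injective g ∧
      Filter.Tendsto (fun i => ρ (g i) y) Filter.atTop (nhds ξ)}

/-- Conical limit point. -/
def IsConicalLimitPoint (ρ : G →* (X ≃ₜ X)) (ζ : X) : Prop :=
  ∃ (g : ℕ → G) (ξ₀ ξ₁ : X), ξ₀ ≠ ξ₁ ∧
    ConvTo (fun i x => ρ (g i) x) ζ ξ₀ ∧
    Filter.Tendsto (fun i => ρ (g i) ζ) Filter.atTop (nhds ξ₁)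

/-- The stabilizer of a point. -/
def ptStab (ρ : G →* (X ≃ₜ X)) (η : X) : Subgroup G where
  carrier := {g | ρ g η = η}
  one_mem' := by simp
  mul_mem' := by
    intro a b ha hb
    simp only [Set.mem_setOf_eq] at *
    rw [map_mul, homeomorph_mul_apply, hb, ha]
  inv_mem' := by
    intro a ha
    simp only [Set.mem_setOf_eq] at *
    have : ρ a⁻¹ (ρ a η) = η := by
      rw [← homeomorph_mul_apply, ← map_mul, inv_mul_cancel, map_one, homeomorph_one_apply]
    rw [ha] at this
    exact this

/-- The setwise stabilizer of a subset. -/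
def setStab (ρ : G →* (X ≃ₜ X)) (C : Set X) : Subgroup G where
  carrier := {g | ∀ x, ρ g x ∈ C ↔ x ∈ C}
  one_mem' := by intro x; simp
  mul_mem' := by
    intro a b ha hb x
    rw [map_mul, homeomorph_mul_apply, ha, hb]
  inv_mem' := by
    intro a ha x
    have h1 := ha (ρ a⁻¹ x)
    have h2 : ρ a (ρ a⁻¹ x) = x := by
      rw [← homeomorph_mul_apply, ← map_mul, mul_inv_cancel, map_one, homeomorph_one_apply]
    rw [h2] at h1
    exact h1.symm

/-- Bounded parabolic point: stabilizer infinite, acting properly discontinuously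
and cocompactly on the complement of the point. -/
def IsBoundedParabolicPoint (ρ : G →* (X ≃ₜ X)) (η : X) : Prop :=
  (ptStab ρ η : Set G).Infinite ∧
  (∀ K : Set X, IsCompact K → K ⊆ {η}ᶜ →
      {g : G | g ∈ ptStab ρ η ∧ ((fun x => ρ g x) '' K ∩ K).Nonempty}.Finite) ∧
  (∃ K : Set X, IsCompact K ∧ K ⊆ {η}ᶜ ∧
      (⋃ g ∈ ptStab ρ η, (fun x => ρ g x) '' K) = {η}ᶜ)

/-- Geometrically finite convergence group action. -/
def IsGeomFiniteAction (ρ : G →* (X ≃ₜ X)) : Prop :=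
  IsConvergenceAction ρ ∧
    ∀ ξ ∈ limitSet ρ, IsConicalLimitPoint ρ ξ ∨ IsBoundedParabolicPoint ρ ξ

/-- Möbius transformation of the Riemann sphere. -/
def IsMobius (f : S2 ≃ₜ S2) : Prop :=
  ∃ a b c d : ℂ, a * d - b * c ≠ 0 ∧
    ((∀ z : ℂ, c * z + d ≠ 0 →
        f (z : S2) = (((a * z + b) / (c * z + d) : ℂ) : S2)) ∨
     (∀ z : ℂ, c * (starRingEnd ℂ) z + d ≠ 0 →
        f (z : S2) = (((a * (starRingEnd ℂ) z + b) / (c * (starRingEnd ℂ) z + d) : ℂ) : S2)))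

/-- Kleinian action: faithful convergence action by Möbius transformations. -/
def IsKleinianAction (ρ : G →* (S2 ≃ₜ S2)) : Prop :=
  Function.Injective ρ ∧ IsConvergenceAction ρ ∧ ∀ g, IsMobius (ρ g)

/-- Geometrically finite Kleinian action. -/
def IsGFKleinianAction (ρ : G →* (S2 ≃ₜ S2)) : Prop :=
  Function.Injective ρ ∧ IsGeomFiniteAction ρ ∧ ∀ g, IsMobius (ρ g)

/-- The action conjugated by a homeomorphism `h`: `g ↦ h ∘ ρ g ∘ h⁻¹`. -/
def conjAction (ρ : G →* (X ≃ₜ X)) (h : X ≃ₜ X) : G →* (X ≃ₜ X) where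
  toFun g := (h.symm.trans (ρ g)).trans h
  map_one' := by
    ext x
    simp [Homeomorph.trans_apply]
  map_mul' := by
    intro a b
    ext x
    simp [Homeomorph.trans_apply, map_mul]

/-- A group is virtually abelian. -/
def VirtuallyAbelian (H : Type*) [Group H] : Prop :=
  ∃ A : Subgroup H, A.FiniteIndex ∧ ∀ a b : A, a * b = b * a

/-- The standard Sierpiński carpet in `ℝ²`. -/
def sierpinskiCarpet : Set (ℝ × ℝ) :=
  {p | ∃ a b : ℕ → ℕ, (∀ i, a i < 3) ∧ (∀ i, b i < 3) ∧
      p.1 = ∑' i : ℕ, (a i : ℝ) / 3 ^ (i + 1) ∧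
      p.2 = ∑' i : ℕ, (b i : ℝ) / 3 ^ (i + 1) ∧
      ∀ i, ¬(a i = 1 ∧ b i = 1)}

/-- `M` contains an embedded Sierpiński carpet. -/
def ContainsCarpet {Y : Type*} [TopologicalSpace Y] (M : Set Y) : Prop :=
  ∃ f : sierpinskiCarpet → Y, Continuous f ∧ Function.Injective f ∧ ∀ x, f x ∈ M

end


theorem quot_exists {X : Type} [MetricSpace X] [SecondCountableTopology X] {ι : Type} (A : ι → Set X)
    (hc : ∀ i, IsClosed (A i)) (hd : ∀ i j x, x ∈ A i → x ∈ A j → i = j)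
    (hn : ∀ η > 0, {i | ∃ x ∈ A i, ∃ y ∈ A i, η ≤ dist x y}.Finite)
    (B : Set X) (hB : IsCompact B) (hBA : ∀ x, ∃ y ∈ B, x = y ∨ ∃ i, x ∈ A i ∧ y ∈ A i) :
    ∃ (Y : Type) (_ : MetricSpace Y) (_ : CompactSpace Y) (π : X → Y), Continuous π ∧
      Function.Surjective π ∧ ∀ x y, π x = π y ↔ (x = y ∨ ∃ i, x ∈ A i ∧ y ∈ A i) := by
  let s : Setoid X :=
    { r := fun x y => x = y ∨ ∃ i, x ∈ A i ∧ y ∈ A i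
      iseqv := by
        refine ⟨fun x => Or.inl rfl, ?_, ?_⟩
        · rintro x y (h | ⟨i, h1, h2⟩)
          · exact Or.inl h.symm
          · exact Or.inr ⟨i, h2, h1⟩
        · rintro x y z (rfl | ⟨i, h1, h2⟩) h'
          · exact h'
          · rcases h' with rfl | ⟨j, h3, h4⟩
            · exact Or.inr ⟨i, h1, h2⟩
            · obtain rfl := hd i j y h2 h3
              exact Or.inr ⟨i, h1, h4⟩ }
  let π : X → Quotient s := Quotient.mk s
  have hπ : ∀ x y, π x = π y ↔ (x = y ∨ ∃ i, x ∈ A i ∧ y ∈ A i) := fun x y => Quotient.eq (r := s)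
  have hq : IsQuotientMap π := isQuotientMap_quotient_mk'
  have hcont : Continuous π := hq.continuous
  have hsurj : Function.Surjective π := hq.surjective
  have hcl : IsClosedMap π := by
    intro C hC
    rw [← hq.isClosed_preimage, ← isOpen_compl_iff, isOpen_iff_mem_nhds]
    intro z hz
    have hz' : ∀ y ∈ C, ¬ (z = y ∨ ∃ i, z ∈ A i ∧ y ∈ A i) := by
      intro y hy h
      exact hz ⟨y, hy, ((hπ z y).2 h).symm⟩
    have hzC : z ∉ C := fun h => hz' z h (Or.inl rfl)
    obtain ⟨d, hd0, hdC⟩ := Metric.isOpen_iff.1 hC.isOpen_compl z hzC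
    have hfin := hn (d/2) (by positivity)
    set T := ⋃ i ∈ {i | (∃ x ∈ A i, ∃ y ∈ A i, d/2 ≤ dist x y)} ∩ {i | (A i ∩ C).Nonempty}, A i with hT
    have hTc : IsClosed T := (hfin.subset inter_subset_left).isClosed_biUnion (fun i _ => hc i)
    have hzT : z ∉ T := by
      intro h
      simp only [hT, mem_iUnion] at h
      obtain ⟨i, ⟨_, ⟨y, hy1, hy2⟩⟩, hzi⟩ := h
      exact hz' y hy2 (Or.inr ⟨i, hzi, hy1⟩)
    filter_upwards [hTc.isOpen_compl.mem_nhds hzT, Metric.ball_mem_nhds z (show (0:ℝ) < d/2 by positivity)]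
      with u hu1 hu2
    rintro ⟨y, hyC, hyu⟩
    have hyd : d ≤ dist y z := by
      by_contra h
      exact hdC (by simpa using h) hyC
    rcases (hπ y u).1 hyu with rfl | ⟨i, h1, h2⟩
    · rw [Metric.mem_ball] at hu2; linarith
    · apply hu1
      simp only [hT, mem_iUnion]
      refine ⟨i, ⟨⟨y, h1, u, h2, ?_⟩, ⟨y, h1, hyC⟩⟩, h2⟩
      rw [Metric.mem_ball] at hu2
      linarith [dist_triangle y u z]
  have hop : ∀ U : Set X, IsOpen U → IsOpen (π '' Uᶜ)ᶜ := fun U hU =>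
    (hcl _ hU.isClosed_compl).isOpen_compl
  have hfib : ∀ x, IsClosed (π ⁻¹' {π x}) := by
    intro x
    have : IsClosed ({π x} : Set (Quotient s)) := by
      have := hcl {x} isClosed_singleton
      simpa using this
    exact this.preimage hcont
  have hcomp : CompactSpace (Quotient s) := by
    refine ⟨?_⟩
    have : π '' B = univ := by
      rw [eq_univ_iff_forall]
      intro y
      obtain ⟨x, rfl⟩ := hsurj y
      obtain ⟨b, hb, h⟩ := hBA x
      exact ⟨b, hb, ((hπ x b).2 h).symm⟩
    rw [← this]
    exact hB.image hcont
  have hT2 : T2Space (Quotient s) := by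
    refine ⟨fun a b hab => ?_⟩
    obtain ⟨x, rfl⟩ := hsurj a
    obtain ⟨y, rfl⟩ := hsurj b
    have hdis : Disjoint (π ⁻¹' {π x}) (π ⁻¹' {π y}) := by
      rw [Set.disjoint_left]
      intro z h1 h2
      exact hab (h1.symm.trans h2)
    obtain ⟨U, V, hU, hV, hxU, hyV, hUV⟩ := normal_separation (hfib x) (hfib y) hdis
    refine ⟨_, _, hop U hU, hop V hV, ?_, ?_, ?_⟩
    · rintro ⟨z, hz, hzx⟩; exact hz (hxU hzx)
    · rintro ⟨z, hz, hzx⟩; exact hz (hyV hzx)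
    · rw [Set.disjoint_left]
      intro w h1 h2
      obtain ⟨z, rfl⟩ := hsurj w
      have h3 : z ∈ U := by by_contra h; exact h1 ⟨z, h, rfl⟩
      have h4 : z ∈ V := by by_contra h; exact h2 ⟨z, h, rfl⟩
      exact Set.disjoint_left.1 hUV h3 h4
  have hsc : SecondCountableTopology (Quotient s) := by
    obtain ⟨b, hbc, -, hb⟩ := TopologicalSpace.exists_countable_basis X
    let F : Set (Set (Set X)) := {t | t.Finite ∧ t ⊆ b}
    have hF : F.Countable := Set.countable_ofPred_finite_subset hbc
    have hbas : TopologicalSpace.IsTopologicalBasis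
        ((fun t : Set (Set X) => (π '' (B \ ⋃₀ t))ᶜ) '' F) := by
      refine TopologicalSpace.isTopologicalBasis_of_isOpen_of_nhds ?_ ?_
      · rintro _ ⟨t, ht, rfl⟩
        exact (hcl _ (hB.isClosed.sdiff
          (isOpen_sUnion fun u hu => hb.isOpen (ht.2 hu)))).isOpen_compl
      · intro a u hau hu
        obtain ⟨x, rfl⟩ := hsurj a
        have hcompact : IsCompact (π ⁻¹' {π x} ∩ B) := hB.inter_left (hfib x)
        obtain ⟨t, htb, htf, htc⟩ := hcompact.elim_finite_subcover_image
          (b := {v | v ∈ b ∧ v ⊆ π ⁻¹' u}) (c := id) (fun v hv => hb.isOpen hv.1) (by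
            rintro z ⟨hz, -⟩
            have hzu : z ∈ π ⁻¹' u := by
              have : π z = π x := hz
              simpa [this] using hau
            obtain ⟨v, hv, hzv, hvu⟩ := hb.exists_subset_of_mem_open hzu (hu.preimage hcont)
            exact mem_biUnion (x := v) ⟨hv, hvu⟩ hzv)
        refine ⟨_, ⟨t, ⟨htf, fun v hv => (htb hv).1⟩, rfl⟩, ?_, ?_⟩
        · rintro ⟨z, ⟨hzB, hzt⟩, hzx⟩
          have := htc ⟨hzx, hzB⟩
          simp only [mem_iUnion] at this
          obtain ⟨v, hv, hzv⟩ := this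
          exact hzt ⟨v, hv, hzv⟩
        · intro y hy
          obtain ⟨w, rfl⟩ := hsurj y
          obtain ⟨z, hzB, hz⟩ := hBA w
          have hwz : π w = π z := (hπ w z).2 hz
          rw [hwz] at hy ⊢
          by_contra hzu
          apply hy
          refine ⟨z, ⟨hzB, ?_⟩, rfl⟩
          rintro ⟨v, hv, hzv⟩
          exact hzu ((htb hv).2 hzv)
    exact hbas.secondCountableTopology (hF.image _)
  have hm : TopologicalSpace.MetrizableSpace (Quotient s) := inferInstance
  let _ : MetricSpace (Quotient s) := TopologicalSpace.metrizableSpaceMetric _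
  exact ⟨Quotient s, inferInstance, hcomp, π, hcont, hsurj, hπ⟩

abbrev Pl : Type := ℝ × ℝ

theorem radial_homeo (c : Pl) (s δ l : ℝ) (hs : 0 < s) (hδ : 0 < δ) (hl : 0 < l) (hl1 : l < 1) :
    ∃ κ : Pl ≃ₜ Pl, (∀ x, s + δ ≤ dist x c → κ x = x) ∧
      κ '' Metric.closedBall c s = Metric.closedBall c (l * s) ∧
      ∀ x, dist (κ x) x ≤ (1 - l) * (s + δ) := by
  let χ : ℝ → ℝ := fun t => l + (1 - l) * max 0 (min 1 ((t - s) / δ))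
  have hχc : Continuous χ := by fun_prop
  have hχs : ∀ t ≤ s, χ t = l := by
    intro t ht
    have : (t - s) / δ ≤ 0 := div_nonpos_of_nonpos_of_nonneg (by linarith) hδ.le
    have : max 0 (min 1 ((t - s) / δ)) = 0 := max_eq_left ((min_le_right _ _).trans this)
    simp [χ, this]
  have hχb : ∀ t, s + δ ≤ t → χ t = 1 := by
    intro t ht
    have : 1 ≤ (t - s) / δ := by rw [le_div_iff₀ hδ]; linarith
    simp [χ, min_eq_left this]
  have hχl : ∀ t, l ≤ χ t := fun t => by
    have : 0 ≤ (1 - l) * max 0 (min 1 ((t - s) / δ)) :=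
      mul_nonneg (by linarith) (le_max_left _ _)
    simp only [χ]; linarith
  have hχ1 : ∀ t, χ t ≤ 1 := fun t => by
    have h1 : max 0 (min 1 ((t - s) / δ)) ≤ 1 := max_le zero_le_one (min_le_left _ _)
    have := mul_le_mul_of_nonneg_left h1 (show 0 ≤ 1 - l by linarith)
    simp only [χ]; linarith
  have hχm : Monotone χ := by
    intro a b hab
    have : (a - s) / δ ≤ (b - s) / δ := by gcongr
    have h2 : max 0 (min 1 ((a - s) / δ)) ≤ max 0 (min 1 ((b - s) / δ)) :=
      max_le_max le_rfl (min_le_min le_rfl this)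
    have := mul_le_mul_of_nonneg_left h2 (show 0 ≤ 1 - l by linarith)
    simp only [χ]; linarith
  have hχpos : ∀ t, 0 < χ t := fun t => hl.trans_le (hχl t)
  let k : Pl → Pl := fun x => c + χ ‖x - c‖ • (x - c)
  have hkc : Continuous k := by fun_prop
  have hknorm : ∀ x, ‖k x - c‖ = χ ‖x - c‖ * ‖x - c‖ := by
    intro x
    simp only [k, add_sub_cancel_left, norm_smul, Real.norm_eq_abs, abs_of_pos (hχpos _)]
  have hmono : ∀ a b, 0 ≤ a → a < b → χ a * a < χ b * b := by
    intro a b ha hab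
    have := hχm hab.le
    have := hχpos b
    nlinarith
  have hinj : Function.Injective k := by
    intro x y hxy
    have h1 : χ ‖x - c‖ * ‖x - c‖ = χ ‖y - c‖ * ‖y - c‖ := by rw [← hknorm, ← hknorm, hxy]
    have h2 : ‖x - c‖ = ‖y - c‖ := by
      rcases lt_trichotomy ‖x - c‖ ‖y - c‖ with h | h | h
      · exact absurd h1 (hmono _ _ (norm_nonneg _) h).ne
      · exact h
      · exact absurd h1 (hmono _ _ (norm_nonneg _) h).ne'
    have h3 : χ ‖x - c‖ • (x - c) = χ ‖x - c‖ • (y - c) := by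
      have := hxy
      simp only [k] at this
      rw [← h2] at this
      exact add_left_cancel this
    have h4 := smul_right_injective Pl (hχpos ‖x - c‖).ne' h3
    exact sub_left_injective h4
  have hsurj : Function.Surjective k := by
    intro w
    by_cases hw : w = c
    · exact ⟨c, by simp [k, hw]⟩
    have hw0 : 0 < ‖w - c‖ := norm_pos_iff.2 (sub_ne_zero.2 hw)
    set R := ‖w - c‖ with hR
    have hcon : ContinuousOn (fun t => χ t * t) (Icc 0 (R / l)) := by fun_prop
    have h0 : R ∈ Icc (χ 0 * 0) (χ (R / l) * (R / l)) := by
      refine ⟨by simp [hw0.le], ?_⟩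
      have := mul_le_mul_of_nonneg_right (hχl (R / l)) (show 0 ≤ R / l by positivity)
      rwa [mul_div_cancel₀ _ hl.ne'] at this
    obtain ⟨t, ht, htR⟩ := intermediate_value_Icc (by positivity) hcon h0
    simp only at htR
    have hn : ‖(t / R) • (w - c)‖ = t := by
      rw [norm_smul, Real.norm_eq_abs, abs_of_nonneg (div_nonneg ht.1 hw0.le), ← hR,
        div_mul_cancel₀ _ hw0.ne']
    refine ⟨c + (t / R) • (w - c), ?_⟩
    simp only [k, add_sub_cancel_left, hn, smul_smul]
    rw [← mul_div_assoc, htR, div_self hw0.ne']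
    simp
  have hprop : IsProperMap k := by
    rw [isProperMap_iff_tendsto_cocompact]
    refine ⟨hkc, ?_⟩
    rw [← Metric.cobounded_eq_cocompact, ← tendsto_norm_atTop_iff_cobounded]
    have h1 : Tendsto (fun x : Pl => l * (‖x‖ - ‖c‖) - ‖c‖) (Bornology.cobounded Pl) atTop := by
      apply tendsto_atTop_add_const_right
      apply Tendsto.const_mul_atTop hl
      apply tendsto_atTop_add_const_right
      exact tendsto_norm_cobounded_atTop
    refine tendsto_atTop_mono (fun x => ?_) h1
    have h2 := hknorm x
    have h3 := mul_le_mul_of_nonneg_right (hχl ‖x - c‖) (norm_nonneg (x - c))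
    have h4 := mul_le_mul_of_nonneg_left (norm_sub_norm_le x c) hl.le
    have h5 := norm_sub_le (k x) c
    linarith
  let e := Equiv.ofBijective k ⟨hinj, hsurj⟩
  let κ : Pl ≃ₜ Pl := e.toHomeomorphOfContinuousClosed hkc hprop.isClosedMap
  have hκ : ∀ x, κ x = k x := fun x => rfl
  refine ⟨κ, ?_, ?_, ?_⟩
  · intro x hx
    rw [dist_eq_norm] at hx
    simp [hκ, k, hχb _ hx]
  · ext y
    constructor
    · rintro ⟨x, hx, rfl⟩
      rw [Metric.mem_closedBall, dist_eq_norm] at hx ⊢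
      rw [hκ, hknorm, hχs _ hx]
      gcongr
    · intro hy
      rw [Metric.mem_closedBall, dist_eq_norm] at hy
      have hn : ‖l⁻¹ • (y - c)‖ ≤ s := by
        rw [norm_smul, Real.norm_eq_abs, abs_of_pos (inv_pos.2 hl), inv_mul_le_iff₀ hl]
        exact hy
      refine ⟨c + l⁻¹ • (y - c), ?_, ?_⟩
      · rw [Metric.mem_closedBall, dist_eq_norm]; simpa using hn
      · rw [hκ]
        simp only [k, add_sub_cancel_left]
        rw [hχs _ hn, smul_smul, mul_inv_cancel₀ hl.ne']
        simp
  · intro x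
    have h1 : κ x - x = -((1 - χ ‖x - c‖) • (x - c)) := by
      rw [hκ]; simp only [k]; module
    rw [dist_eq_norm, h1, norm_neg, norm_smul, Real.norm_eq_abs,
      abs_of_nonneg (by linarith [hχ1 ‖x - c‖])]
    by_cases h : s + δ ≤ ‖x - c‖
    · rw [hχb _ h]; simp; exact mul_nonneg (by linarith) (by linarith)
    · exact mul_le_mul (by linarith [hχl ‖x - c‖]) (not_le.1 h).le (norm_nonneg _) (by linarith)

theorem homeo_uc (q : Pl ≃ₜ Pl) (U : Set Pl) (hU : Bornology.IsBounded U) (h : ∀ x ∉ U, q x = x) :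
    UniformContinuous q := by
  have hsup : HasCompactSupport (fun x => q x - x) := by
    refine HasCompactSupport.intro hU.isCompact_closure (fun x hx => ?_)
    rw [h x (fun hx' => hx (subset_closure hx')), sub_self]
  have h1 : UniformContinuous (fun x => q x - x) :=
    hsup.uniformContinuous_of_continuous (by fun_prop)
  have := h1.add uniformContinuous_id
  simpa using this

theorem shrink_aux {ι : Type} (c : ι → Pl) (r : ι → ℝ) (hr : ∀ i, 0 < r i)
    (hd : ∀ i j x, x ∈ Metric.closedBall (c i) (r i) → x ∈ Metric.closedBall (c j) (r j) → i = j)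
    (hn : ∀ η > 0, {i | ∃ x ∈ Metric.closedBall (c i) (r i),
      ∃ y ∈ Metric.closedBall (c i) (r i), η ≤ dist x y}.Finite)
    (i : ι) (W : Set Pl) (hW : IsOpen W) (hWb : Bornology.IsBounded W)
    (hiW : Metric.closedBall (c i) (r i) ⊆ W) (τ : ℝ) (hτ : 0 < τ) (l : ℝ) (hl : 0 < l) (hl1 : l < 1)
    (hlτ : (1 - l) * (2 * r i) ≤ τ) (j : ℕ) :
    ∃ k : Pl ≃ₜ Pl, (∀ x ∉ W, k x = x) ∧
      k '' Metric.closedBall (c i) (r i) = Metric.closedBall (c i) (l ^ j * r i) ∧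
      ∀ m ≠ i, (∀ x ∈ Metric.closedBall (c m) (r m), k x = x) ∨
        ∀ x ∈ Metric.closedBall (c m) (r m), ∀ y ∈ Metric.closedBall (c m) (r m),
          dist (k x) (k y) < 3 * τ := by
  induction j with
  | zero => exact ⟨Homeomorph.refl _, fun x _ => rfl, by simp, fun m _ => Or.inl fun x _ => rfl⟩
  | succ j ih =>
    obtain ⟨k, hkW, hki, hkm⟩ := ih
    have huc := homeo_uc k W hWb hkW
    obtain ⟨ω, hω, hωk⟩ := Metric.uniformContinuous_iff.1 huc τ hτ
    set s := l ^ j * r i with hs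
    have hs0 : 0 < s := mul_pos (pow_pos hl j) (hr i)
    have hsr : s ≤ r i := mul_le_of_le_one_left (hr i).le (pow_le_one₀ hl.le hl1.le)
    set Bad := {m | ∃ x ∈ Metric.closedBall (c m) (r m),
      ∃ y ∈ Metric.closedBall (c m) (r m), ω ≤ dist x y} ∩ {m | m ≠ i} with hBad
    have hBf : Bad.Finite := (hn ω hω).subset inter_subset_left
    set T := ⋃ m ∈ Bad, k '' Metric.closedBall (c m) (r m) with hT
    have hTc : IsClosed T := hBf.isClosed_biUnion fun m _ =>
      k.isClosedMap _ Metric.isClosed_closedBall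
    have hsub : Metric.closedBall (c i) s ⊆ Tᶜ ∩ W := by
      intro x hx
      refine ⟨?_, hiW (Metric.closedBall_subset_closedBall hsr hx)⟩
      intro hxT
      simp only [hT, mem_iUnion] at hxT
      obtain ⟨m, hm, y, hy, rfl⟩ := hxT
      rw [← hki] at hx
      obtain ⟨z, hz, hzy⟩ := hx
      obtain rfl := k.injective hzy
      exact hm.2 (hd _ _ z hy hz)
    obtain ⟨δ, hδ, hδs⟩ := (isCompact_closedBall (c i) s).exists_thickening_subset_open
      (hTc.isOpen_compl.inter hW) hsub
    rw [thickening_closedBall hδ hs0.le] at hδs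
    obtain ⟨κ, hκ1, hκ2, hκ3⟩ := radial_homeo (c i) s (min δ s) l hs0 (lt_min hδ hs0) hl hl1
    have hκfix : ∀ x, x ∉ Tᶜ ∩ W → κ x = x := by
      intro x hx
      apply hκ1
      by_contra h
      apply hx
      apply hδs
      rw [Metric.mem_ball]
      have := min_le_left δ s
      linarith
    have hκd : ∀ x, dist (κ x) x ≤ τ := by
      intro x
      refine (hκ3 x).trans (le_trans ?_ hlτ)
      have := min_le_right δ s
      exact mul_le_mul_of_nonneg_left (by linarith) (by linarith)
    refine ⟨k.trans κ, ?_, ?_, ?_⟩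
    · intro x hx
      rw [Homeomorph.trans_apply, hkW x hx]
      exact hκfix x fun h => hx h.2
    · rw [show (⇑(k.trans κ)) = κ ∘ k from rfl, image_comp, hki, hκ2, hs, pow_succ]
      congr 1; ring
    · intro m hm
      by_cases hmB : m ∈ Bad
      · have : ∀ x ∈ Metric.closedBall (c m) (r m), κ (k x) = k x := by
          intro x hx
          apply hκfix
          intro h
          apply h.1
          simp only [hT, mem_iUnion]
          exact ⟨m, hmB, x, hx, rfl⟩
        rcases hkm m hm with h | h
        · left; intro x hx; rw [Homeomorph.trans_apply, this x hx, h x hx]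
        · right; intro x hx y hy
          rw [Homeomorph.trans_apply, Homeomorph.trans_apply, this x hx, this y hy]
          exact h x hx y hy
      · right
        intro x hx y hy
        rw [Homeomorph.trans_apply, Homeomorph.trans_apply]
        have h1 : dist x y < ω := by
          by_contra h
          exact hmB ⟨⟨x, hx, y, hy, not_lt.1 h⟩, hm⟩
        have h2 := hωk h1
        have h3 := hκd (k x)
        have h4 := hκd (k y)
        have h5 := dist_triangle4 (κ (k x)) (k x) (k y) (κ (k y))
        rw [dist_comm (k y) (κ (k y))] at h5
        linarith

theorem shrink {ι : Type} (c : ι → Pl) (r : ι → ℝ) (hr : ∀ i, 0 < r i)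
    (hd : ∀ i j x, x ∈ Metric.closedBall (c i) (r i) → x ∈ Metric.closedBall (c j) (r j) → i = j)
    (hn : ∀ η > 0, {i | ∃ x ∈ Metric.closedBall (c i) (r i),
      ∃ y ∈ Metric.closedBall (c i) (r i), η ≤ dist x y}.Finite)
    (i : ι) (W : Set Pl) (hW : IsOpen W) (hWb : Bornology.IsBounded W)
    (hiW : Metric.closedBall (c i) (r i) ⊆ W) (θ : ℝ) (hθ : 0 < θ) :
    ∃ k : Pl ≃ₜ Pl, (∀ x ∉ W, k x = x) ∧
      (∀ x ∈ Metric.closedBall (c i) (r i), ∀ y ∈ Metric.closedBall (c i) (r i),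
          dist (k x) (k y) < θ) ∧
      ∀ m ≠ i, (∀ x ∈ Metric.closedBall (c m) (r m), k x = x) ∨
        ∀ x ∈ Metric.closedBall (c m) (r m), ∀ y ∈ Metric.closedBall (c m) (r m),
          dist (k x) (k y) < θ := by
  have hri := hr i
  have hL : 0 < min (1/2) (θ / 3 / (2 * r i)) := lt_min (by norm_num) (by positivity)
  set l := 1 - min (1/2) (θ / 3 / (2 * r i)) with hl
  have hl0 : 0 < l := by
    have := min_le_left (1/2) (θ / 3 / (2 * r i)); linarith
  have hl1 : l < 1 := by linarith
  have hlτ : (1 - l) * (2 * r i) ≤ θ / 3 := by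
    rw [← le_div_iff₀ (by positivity)]
    have := min_le_right (1/2) (θ / 3 / (2 * r i)); linarith
  obtain ⟨j, hj⟩ := exists_pow_lt_of_lt_one (show 0 < θ / (2 * r i) by positivity) hl1
  obtain ⟨k, h1, h2, h3⟩ := shrink_aux c r hr hd hn i W hW hWb hiW (θ/3) (by positivity) l hl0 hl1 hlτ j
  refine ⟨k, h1, ?_, ?_⟩
  · intro x hx y hy
    have hx' : k x ∈ Metric.closedBall (c i) (l ^ j * r i) := h2 ▸ mem_image_of_mem k hx
    have hy' : k y ∈ Metric.closedBall (c i) (l ^ j * r i) := h2 ▸ mem_image_of_mem k hy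
    rw [Metric.mem_closedBall] at hx' hy'
    rw [lt_div_iff₀ (by positivity)] at hj
    have := dist_triangle_right (k x) (k y) (c i)
    linarith
  · have : 3 * (θ / 3) = θ := by ring
    rwa [this] at h3

theorem bing_step {ι : Type} (c : ι → Pl) (r : ι → ℝ) (hr : ∀ i, 0 < r i)
    (hd : ∀ i j x, x ∈ Metric.closedBall (c i) (r i) → x ∈ Metric.closedBall (c j) (r j) → i = j)
    (hn : ∀ η > 0, {i | ∃ x ∈ Metric.closedBall (c i) (r i),
      ∃ y ∈ Metric.closedBall (c i) (r i), η ≤ dist x y}.Finite)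
    (U : Set Pl) (hU : IsOpen U) (hUb : Bornology.IsBounded U)
    (hcU : ∀ i, Metric.closedBall (c i) (r i) ⊆ U)
    {Y : Type} [MetricSpace Y] (π : Pl → Y) (hπ : Continuous π)
    (hπc : ∀ i, ∀ x ∈ Metric.closedBall (c i) (r i), π x = π (c i)) (η : ℝ) (hη : 0 < η) (N : ℕ) :
    ∀ (q : Pl ≃ₜ Pl), (∀ x ∉ U, q x = x) →
    {i | ∃ x ∈ Metric.closedBall (c i) (r i),
      ∃ y ∈ Metric.closedBall (c i) (r i), η ≤ dist (q x) (q y)}.ncard = N →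
    ∀ ε > 0, ∃ k : Pl ≃ₜ Pl, (∀ x ∉ U, k x = x) ∧ (∀ x, dist (π (k x)) (π x) < ε) ∧
      ∀ i, ∀ x ∈ Metric.closedBall (c i) (r i), ∀ y ∈ Metric.closedBall (c i) (r i),
        dist (q (k x)) (q (k y)) < η := by
  induction N using Nat.strong_induction_on with
  | _ N ih =>
  intro q hq hN ε hε
  set Big := {i | ∃ x ∈ Metric.closedBall (c i) (r i),
      ∃ y ∈ Metric.closedBall (c i) (r i), η ≤ dist (q x) (q y)} with hBig
  obtain ⟨ω, hω, hωq⟩ := Metric.uniformContinuous_iff.1 (homeo_uc q U hUb hq) η hη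
  have hBf : Big.Finite := by
    refine (hn ω hω).subset ?_
    rintro i ⟨x, hx, y, hy, h⟩
    refine ⟨x, hx, y, hy, ?_⟩
    by_contra h'
    exact absurd (hωq (not_le.1 h')) (not_lt.2 h)
  rcases Big.eq_empty_or_nonempty with he | ⟨i, hi⟩
  · refine ⟨Homeomorph.refl _, fun _ _ => rfl, fun x => by simpa using hε, ?_⟩
    intro i x hx y hy
    by_contra h
    have : i ∈ Big := ⟨x, hx, y, hy, not_lt.1 h⟩
    simp [he] at this
  · set W := U ∩ π ⁻¹' Metric.ball (π (c i)) (ε / 4) with hW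
    have hWo : IsOpen W := hU.inter (Metric.isOpen_ball.preimage hπ)
    have hiW : Metric.closedBall (c i) (r i) ⊆ W := fun x hx =>
      ⟨hcU i hx, by rw [mem_preimage, hπc i x hx]; exact Metric.mem_ball_self (by positivity)⟩
    obtain ⟨k, hk1, hk2, hk3⟩ := shrink c r hr hd hn i W hWo (hUb.subset inter_subset_left) hiW ω hω
    have hkU : ∀ x ∉ U, k x = x := fun x hx => hk1 x fun h => hx h.1
    have hkW : ∀ x ∈ W, k x ∈ W := by
      intro x hx
      by_contra h
      have := k.injective (hk1 _ h)
      rw [this] at h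
      exact h hx
    have hkd : ∀ x, dist (π (k x)) (π x) < ε / 2 := by
      intro x
      by_cases hx : x ∈ W
      · have h1 := (hkW x hx).2
        have h2 := hx.2
        rw [mem_preimage, Metric.mem_ball] at h1 h2
        have := dist_triangle_right (π (k x)) (π x) (π (c i))
        linarith
      · rw [hk1 x hx, dist_self]; positivity
    have hlt : {i | ∃ x ∈ Metric.closedBall (c i) (r i),
      ∃ y ∈ Metric.closedBall (c i) (r i), η ≤ dist ((k.trans q) x) ((k.trans q) y)}.ncard < N := by
      rw [← hN]
      refine Set.ncard_lt_ncard ?_ hBf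
      refine (Set.ssubset_iff_of_subset ?_).2 ⟨i, hi, ?_⟩
      · rintro m ⟨x, hx, y, hy, h⟩
        simp only [Homeomorph.trans_apply] at h
        by_cases hm : m = i
        · rw [hm]; exact hi
        · rcases hk3 m hm with h' | h'
          · rw [h' x hx, h' y hy] at h
            exact ⟨x, hx, y, hy, h⟩
          · exact absurd (hωq (h' x hx y hy)) (not_lt.2 h)
      · rintro ⟨x, hx, y, hy, h⟩
        exact absurd (hωq (hk2 x hx y hy)) (not_lt.2 h)
    obtain ⟨k2, h1, h2, h3⟩ := ih _ hlt (k.trans q) (fun x hx => by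
      rw [Homeomorph.trans_apply, hkU x hx, hq x hx]) rfl (ε / 2) (by positivity)
    refine ⟨k2.trans k, fun x hx => ?_, fun x => ?_, h3⟩
    · rw [Homeomorph.trans_apply, h1 x hx, hkU x hx]
    · rw [Homeomorph.trans_apply]
      have := dist_triangle (π (k (k2 x))) (π (k2 x)) (π x)
      linarith [hkd (k2 x), h2 x]

theorem exists_injective_map {ι : Type} (c : ι → Pl) (r : ι → ℝ) (hr : ∀ i, 0 < r i)
    (hd : ∀ i j x, x ∈ Metric.closedBall (c i) (r i) → x ∈ Metric.closedBall (c j) (r j) → i = j)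
    (hn : ∀ η > 0, {i | ∃ x ∈ Metric.closedBall (c i) (r i),
      ∃ y ∈ Metric.closedBall (c i) (r i), η ≤ dist x y}.Finite)
    (U : Set Pl) (hU : IsOpen U) (hUb : Bornology.IsBounded U)
    (hcU : ∀ i, Metric.closedBall (c i) (r i) ⊆ U)
    {Y : Type} [MetricSpace Y] [CompactSpace Y] (π : Pl → Y) (hπ : Continuous π)
    (hπe : ∀ x y, π x = π y → x = y ∨ (x ∉ U ∧ y ∉ U) ∨
      ∃ i, x ∈ Metric.closedBall (c i) (r i) ∧ y ∈ Metric.closedBall (c i) (r i))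
    (hπc : ∀ i, ∀ x ∈ Metric.closedBall (c i) (r i), π x = π (c i))
    (D : Set Pl) (hD : IsCompact D) (hDU : D ⊆ U) :
    ∃ f : D → Y, Continuous f ∧ Function.Injective f := by
  have : CompactSpace D := isCompact_iff_compactSpace.1 hD
  let R : Set C(D, Y) := {f | ∃ q : Pl ≃ₜ Pl, (∀ x ∉ U, q x = x) ∧ ∀ x : D, f x = π (q.symm x)}
  let O : ℕ → Set C(D, Y) := fun n => {f | ∀ x y, f x = f y → dist x y < 1 / ((n : ℝ) + 1)}
  have hO : ∀ n, IsOpen (O n) := by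
    intro n
    rw [← isClosed_compl_iff]
    have hcl : IsClosed {p : C(D, Y) × (D × D) |
        p.1 p.2.1 = p.1 p.2.2 ∧ 1 / ((n : ℝ) + 1) ≤ dist p.2.1 p.2.2} := by
      have c1 : Continuous fun p : C(D, Y) × (D × D) => p.1 p.2.1 :=
        continuous_eval.comp (continuous_fst.prodMk (continuous_fst.comp continuous_snd))
      have c2 : Continuous fun p : C(D, Y) × (D × D) => p.1 p.2.2 :=
        continuous_eval.comp (continuous_fst.prodMk (continuous_snd.comp continuous_snd))
      have c3 : Continuous fun p : C(D, Y) × (D × D) => dist p.2.1 p.2.2 :=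
        continuous_dist.comp continuous_snd
      exact (isClosed_eq c1 c2).inter (isClosed_le continuous_const c3)
    have := isClosedMap_fst_of_compactSpace _ hcl
    convert this using 1
    ext f
    simp [O]
  have hdense : ∀ n, ∀ f ∈ R, ∀ ε > 0, ∃ f' ∈ R ∩ O n, dist f' f < ε := by
    rintro n f ⟨q, hq, hf⟩ ε hε
    obtain ⟨k, hk1, hk2, hk3⟩ := bing_step c r hr hd hn U hU hUb hcU π hπ hπc (1 / ((n : ℝ) + 1))
      (by positivity) _ q hq rfl (ε / 2) (by positivity)
    have hq' : ∀ x ∉ U, (k.trans q) x = x := fun x hx => by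
      rw [Homeomorph.trans_apply, hk1 x hx, hq x hx]
    let f' : C(D, Y) := ⟨fun x => π ((k.trans q).symm x), by fun_prop⟩
    refine ⟨f', ⟨⟨k.trans q, hq', fun x => rfl⟩, ?_⟩, ?_⟩
    · intro x y hxy
      have hU' : ∀ x : D, (k.trans q).symm x ∈ U := by
        intro x
        by_contra h
        have := hq' _ h
        rw [Homeomorph.apply_symm_apply] at this
        rw [← this] at h
        exact h (hDU x.2)
      rcases hπe _ _ hxy with h | ⟨h, -⟩ | ⟨i, h1, h2⟩
      · have := Subtype.ext ((k.trans q).symm.injective h)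
        rw [this, dist_self]; positivity
      · exact absurd (hU' x) h
      · have := hk3 i _ h1 _ h2
        have e : ∀ z, q (k ((k.trans q).symm z)) = z := fun z => (k.trans q).apply_symm_apply z
        rw [e, e] at this
        exact this
    · refine lt_of_le_of_lt ((ContinuousMap.dist_le (by positivity)).2 fun x => ?_)
        (show ε / 2 < ε by linarith)
      rw [hf x]
      have := hk2 ((k.trans q).symm x)
      have e : k ((k.trans q).symm x) = q.symm x := k.apply_symm_apply _
      rw [e, dist_comm] at this
      exact this.le
  let E := closure R
  have hEne : Nonempty E :=
    ⟨⟨⟨fun x => π x, by fun_prop⟩, subset_closure ⟨Homeomorph.refl _, fun _ _ => rfl, fun x => rfl⟩⟩⟩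
  have hEc : CompleteSpace E := isClosed_closure.completeSpace_coe
  have hD' : Dense (⋂ n, ((↑) : E → C(D, Y)) ⁻¹' O n) := by
    refine dense_iInter_of_isOpen_nat (fun n => (hO n).preimage continuous_subtype_val) fun n => ?_
    rw [Metric.dense_iff]
    intro f ε hε
    obtain ⟨f1, hf1, hff1⟩ := Metric.mem_closure_iff.1 f.2 (ε / 2) (by positivity)
    obtain ⟨f2, hf2, hff2⟩ := hdense n f1 hf1 (ε / 2) (by positivity)
    refine ⟨⟨f2, subset_closure hf2.1⟩, ?_, hf2.2⟩
    rw [Metric.mem_ball, Subtype.dist_eq]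
    have := dist_triangle f2 f1 (f : C(D, Y))
    rw [dist_comm f1] at this
    simp only
    linarith
  obtain ⟨f, hf⟩ := hD'.nonempty
  refine ⟨f.1, f.1.continuous, fun x y hxy => ?_⟩
  by_contra hne
  obtain ⟨n, hn⟩ := exists_nat_one_div_lt (dist_pos.2 hne)
  exact absurd (mem_iInter.1 hf n x y hxy) (not_lt.2 hn.le)

/-- Letters of the coding: the eight subsquares. -/
abbrev Let8 : Type := {p : Fin 3 × Fin 3 // p ≠ (1, 1)}

/-- The expanding map of the letter. -/
noncomputable def expd (l : Let8) (z : Pl) : Pl :=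
  (3 * z.1 - ((l.1.1 : ℕ) : ℝ), 3 * z.2 - ((l.1.2 : ℕ) : ℝ))

/-- Centers of the holes. -/
noncomputable def cen : List Let8 → Pl
  | [] => (1/2, 1/2)
  | l :: w => ((((l.1.1 : ℕ) : ℝ) + (cen w).1) / 3, (((l.1.2 : ℕ) : ℝ) + (cen w).2) / 3)

/-- Radii of the holes. -/
noncomputable def rad (w : List Let8) : ℝ := 1 / 6 * (1 / 3) ^ w.length

theorem rad_pos (w : List Let8) : 0 < rad w := by unfold rad; positivity

theorem dist_expd (l : Let8) (z : Pl) (w : List Let8) :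
    dist (expd l z) (cen w) = 3 * dist z (cen (l :: w)) := by
  simp only [Prod.dist_eq, Real.dist_eq, expd, cen]
  rw [mul_max_of_nonneg _ _ (by norm_num : (0:ℝ) ≤ 3)]
  congr 1
  · rw [← abs_of_pos (by norm_num : (0:ℝ) < 3), ← abs_mul, abs_of_pos (by norm_num : (0:ℝ) < 3)]
    congr 1; ring
  · rw [← abs_of_pos (by norm_num : (0:ℝ) < 3), ← abs_mul, abs_of_pos (by norm_num : (0:ℝ) < 3)]
    congr 1; ring

theorem rad_cons (l : Let8) (w : List Let8) : rad w = 3 * rad (l :: w) := by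
  simp [rad, pow_succ]; ring

theorem mem_cball_cons (l : Let8) (w : List Let8) (z : Pl) :
    z ∈ Metric.closedBall (cen (l :: w)) (rad (l :: w)) ↔
      expd l z ∈ Metric.closedBall (cen w) (rad w) := by
  rw [Metric.mem_closedBall, Metric.mem_closedBall, dist_expd, rad_cons l w]
  constructor <;> intro h <;> linarith

theorem mem_ball_cons (l : Let8) (w : List Let8) (z : Pl) :
    z ∈ Metric.ball (cen (l :: w)) (rad (l :: w)) ↔
      expd l z ∈ Metric.ball (cen w) (rad w) := by
  rw [Metric.mem_ball, Metric.mem_ball, dist_expd, rad_cons l w]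
  constructor <;> intro h <;> linarith

/-- The open unit square. -/
def opSq : Set Pl := Metric.ball ((1/2, 1/2) : Pl) (1/2)
/-- The closed unit square. -/
def clSq : Set Pl := Metric.closedBall ((1/2, 1/2) : Pl) (1/2)

theorem mem_opSq (z : Pl) : z ∈ opSq ↔ (0 < z.1 ∧ z.1 < 1) ∧ (0 < z.2 ∧ z.2 < 1) := by
  simp only [opSq, Metric.mem_ball, Prod.dist_eq, max_lt_iff, Real.dist_eq, abs_lt]
  constructor
  · rintro ⟨⟨h1, h2⟩, h3, h4⟩; refine ⟨⟨?_, ?_⟩, ?_, ?_⟩ <;> linarith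
  · rintro ⟨⟨h1, h2⟩, h3, h4⟩; refine ⟨⟨?_, ?_⟩, ?_, ?_⟩ <;> linarith

theorem mem_clSq (z : Pl) : z ∈ clSq ↔ (0 ≤ z.1 ∧ z.1 ≤ 1) ∧ (0 ≤ z.2 ∧ z.2 ≤ 1) := by
  simp only [clSq, Metric.mem_closedBall, Prod.dist_eq, max_le_iff, Real.dist_eq, abs_le]
  constructor
  · rintro ⟨⟨h1, h2⟩, h3, h4⟩; refine ⟨⟨?_, ?_⟩, ?_, ?_⟩ <;> linarith
  · rintro ⟨⟨h1, h2⟩, h3, h4⟩; refine ⟨⟨?_, ?_⟩, ?_, ?_⟩ <;> linarith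

theorem mem_cball_nil (z : Pl) : z ∈ Metric.closedBall (cen []) (rad []) ↔
    (1/3 ≤ z.1 ∧ z.1 ≤ 2/3) ∧ (1/3 ≤ z.2 ∧ z.2 ≤ 2/3) := by
  simp only [cen, rad, Metric.mem_closedBall, Prod.dist_eq, max_le_iff, Real.dist_eq, abs_le,
    List.length_nil, pow_zero, mul_one]
  constructor
  · rintro ⟨⟨h1, h2⟩, h3, h4⟩; refine ⟨⟨?_, ?_⟩, ?_, ?_⟩ <;> linarith
  · rintro ⟨⟨h1, h2⟩, h3, h4⟩; refine ⟨⟨?_, ?_⟩, ?_, ?_⟩ <;> linarith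

theorem mem_ball_nil (z : Pl) : z ∈ Metric.ball (cen []) (rad []) ↔
    (1/3 < z.1 ∧ z.1 < 2/3) ∧ (1/3 < z.2 ∧ z.2 < 2/3) := by
  simp only [cen, rad, Metric.mem_ball, Prod.dist_eq, max_lt_iff, Real.dist_eq, abs_lt,
    List.length_nil, pow_zero, mul_one]
  constructor
  · rintro ⟨⟨h1, h2⟩, h3, h4⟩; refine ⟨⟨?_, ?_⟩, ?_, ?_⟩ <;> linarith
  · rintro ⟨⟨h1, h2⟩, h3, h4⟩; refine ⟨⟨?_, ?_⟩, ?_, ?_⟩ <;> linarith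

theorem digit_bound (a : Fin 3) : (0:ℝ) ≤ ((a : ℕ) : ℝ) ∧ ((a : ℕ) : ℝ) ≤ 2 := by
  refine ⟨by positivity, ?_⟩
  exact_mod_cast Nat.le_of_lt_succ a.2

theorem digit_eq (a b : Fin 3) (h1 : ((a : ℕ) : ℝ) < ((b : ℕ) : ℝ) + 1)
    (h2 : ((b : ℕ) : ℝ) < ((a : ℕ) : ℝ) + 1) : a = b := by
  have h1' : (a : ℕ) < (b : ℕ) + 1 := by exact_mod_cast h1
  have h2' : (b : ℕ) < (a : ℕ) + 1 := by exact_mod_cast h2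
  ext; omega

theorem digit_one (a : Fin 3) (h1 : ((a : ℕ) : ℝ) < 2) (h2 : (0:ℝ) < ((a : ℕ) : ℝ)) : a = 1 := by
  have h1' : (a : ℕ) < 2 := by exact_mod_cast h1
  have h2' : 0 < (a : ℕ) := by exact_mod_cast h2
  apply Fin.ext
  show (a : ℕ) = 1
  omega

theorem cball_subset (w : List Let8) : Metric.closedBall (cen w) (rad w) ⊆ opSq := by
  induction w with
  | nil =>
    intro z hz
    rw [mem_cball_nil] at hz
    rw [mem_opSq]
    obtain ⟨⟨h1, h2⟩, h3, h4⟩ := hz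
    refine ⟨⟨?_, ?_⟩, ?_, ?_⟩ <;> linarith
  | cons l w ih =>
    intro z hz
    rw [mem_cball_cons] at hz
    have := ih hz
    rw [mem_opSq] at this ⊢
    simp only [expd] at this
    have := digit_bound l.1.1
    have := digit_bound l.1.2
    refine ⟨⟨?_, ?_⟩, ?_, ?_⟩ <;> linarith

theorem nil_cons_disj (l : Let8) (v : List Let8) (z : Pl)
    (h1 : z ∈ Metric.closedBall (cen []) (rad []))
    (h2 : z ∈ Metric.closedBall (cen (l :: v)) (rad (l :: v))) : False := by
  rw [mem_cball_cons] at h2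
  have h3 := cball_subset v h2
  rw [mem_opSq] at h3
  rw [mem_cball_nil] at h1
  simp only [expd] at h3
  apply l.2
  have e1 : l.1.1 = 1 := digit_one _ (by linarith) (by linarith)
  have e2 : l.1.2 = 1 := digit_one _ (by linarith) (by linarith)
  exact Prod.ext e1 e2

theorem cball_disj (w v : List Let8) (z : Pl) (h1 : z ∈ Metric.closedBall (cen w) (rad w))
    (h2 : z ∈ Metric.closedBall (cen v) (rad v)) : w = v := by
  induction w generalizing v z with
  | nil =>
    cases v with
    | nil => rfl
    | cons l v => exact (nil_cons_disj l v z h1 h2).elim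
  | cons l w ih =>
    cases v with
    | nil => exact (nil_cons_disj l w z h2 h1).elim
    | cons m v =>
      rw [mem_cball_cons] at h1 h2
      have h3 := cball_subset _ h1
      have h4 := cball_subset _ h2
      rw [mem_opSq] at h3 h4
      simp only [expd] at h3 h4
      have e : l = m := by
        apply Subtype.ext
        apply Prod.ext
        · apply digit_eq <;> linarith
        · apply digit_eq <;> linarith
      subst e
      rw [ih v _ h1 h2]

theorem null_fam (η : ℝ) (hη : 0 < η) : {w : List Let8 | ∃ x ∈ Metric.closedBall (cen w) (rad w),
      ∃ y ∈ Metric.closedBall (cen w) (rad w), η ≤ dist x y}.Finite := by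
  obtain ⟨n, hn⟩ := exists_pow_lt_of_lt_one hη (show (1/3 : ℝ) < 1 by norm_num)
  refine (List.finite_length_le Let8 n).subset ?_
  rintro w ⟨x, hx, y, hy, h⟩
  by_contra hw
  simp only [mem_ofPred_eq, not_le] at hw
  rw [Metric.mem_closedBall] at hx hy
  have h1 := dist_triangle_right x y (cen w)
  have h2 : (1/3 : ℝ) ^ w.length ≤ (1/3) ^ n :=
    pow_le_pow_of_le_one (by norm_num) (by norm_num) hw.le
  have h3 : 0 < (1/3 : ℝ) ^ w.length := by positivity
  unfold rad at hx hy
  linarith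

theorem digit_summable (a : ℕ → ℕ) (ha : ∀ i, a i < 3) :
    Summable (fun i => (a i : ℝ) / 3 ^ (i + 1)) := by
  refine Summable.of_nonneg_of_le (fun i => by positivity) (fun i => ?_)
    (summable_geometric_of_lt_one (by norm_num : (0:ℝ) ≤ 1/3) (by norm_num))
  have : (a i : ℝ) ≤ 3 := by exact_mod_cast (ha i).le
  rw [div_le_iff₀ (by positivity), pow_succ, ← mul_assoc, ← mul_pow]
  norm_num
  exact (ha i).le

theorem digit_tail (a : ℕ → ℕ) (ha : ∀ i, a i < 3) :
    3 * (∑' i : ℕ, (a i : ℝ) / 3 ^ (i + 1)) - (a 0 : ℝ) = ∑' i : ℕ, (a (i + 1) : ℝ) / 3 ^ (i + 1) := by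
  rw [(digit_summable a ha).tsum_eq_zero_add, mul_add, ← tsum_mul_left]
  have : ∀ i : ℕ, 3 * ((a (i + 1) : ℝ) / 3 ^ (i + 1 + 1)) = (a (i + 1) : ℝ) / 3 ^ (i + 1) := by
    intro i; rw [pow_succ (3:ℝ) (i + 1)]; field_simp
  simp only [this]
  simp
  ring

theorem digit_range (a : ℕ → ℕ) (ha : ∀ i, a i < 3) :
    0 ≤ (∑' i : ℕ, (a i : ℝ) / 3 ^ (i + 1)) ∧ (∑' i : ℕ, (a i : ℝ) / 3 ^ (i + 1)) ≤ 1 := by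
  refine ⟨tsum_nonneg fun i => by positivity, ?_⟩
  have hs : HasSum (fun i : ℕ => 2 / 3 * (1/3 : ℝ) ^ i) (2 / 3 * (1 - 1/3)⁻¹) :=
    (hasSum_geometric_of_lt_one (by norm_num) (by norm_num)).mul_left _
  have h2 := (digit_summable a ha).tsum_le_tsum (fun i => ?_) hs.summable
  · rw [hs.tsum_eq] at h2
    norm_num at h2 ⊢
    exact h2
  · have : (a i : ℝ) ≤ 2 := by exact_mod_cast Nat.le_of_lt_succ (ha i)
    rw [pow_succ, one_div, inv_pow, div_le_iff₀ (by positivity)]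
    field_simp
    linarith

theorem carpet_subset : sierpinskiCarpet ⊆ clSq := by
  rintro z ⟨a, b, ha, hb, h1, h2, -⟩
  rw [mem_clSq, h1, h2]
  exact ⟨digit_range a ha, digit_range b hb⟩

theorem carpet_tail (z : Pl) (hz : z ∈ sierpinskiCarpet) : ∃ l : Let8, expd l z ∈ sierpinskiCarpet := by
  obtain ⟨a, b, ha, hb, h1, h2, h3⟩ := hz
  refine ⟨⟨(⟨a 0, ha 0⟩, ⟨b 0, hb 0⟩), ?_⟩, fun i => a (i + 1), fun i => b (i + 1),
    fun i => ha _, fun i => hb _, ?_, ?_, fun i => h3 _⟩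
  · intro h
    apply h3 0
    have e1 := congrArg (fun p => (p.1 : ℕ)) h
    have e2 := congrArg (fun p => (p.2 : ℕ)) h
    exact ⟨by simpa using e1, by simpa using e2⟩
  · simp only [expd]; rw [h1, ← digit_tail a ha]
  · simp only [expd]; rw [h2, ← digit_tail b hb]

theorem ball_not_carpet (w : List Let8) (z : Pl) (h : z ∈ Metric.ball (cen w) (rad w)) :
    z ∉ sierpinskiCarpet := by
  induction w generalizing z with
  | nil =>
    intro hz
    obtain ⟨l, hl⟩ := carpet_tail z hz
    have h2 := carpet_subset hl
    rw [mem_clSq] at h2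
    rw [mem_ball_nil] at h
    simp only [expd] at h2
    apply l.2
    have e1 : l.1.1 = 1 := digit_one _ (by linarith) (by linarith)
    have e2 : l.1.2 = 1 := digit_one _ (by linarith) (by linarith)
    exact Prod.ext e1 e2
  | cons m w ih =>
    intro hz
    obtain ⟨l, hl⟩ := carpet_tail z hz
    have h2 := carpet_subset hl
    rw [mem_ball_cons] at h
    have h3 := cball_subset _ (Metric.ball_subset_closedBall h)
    rw [mem_clSq] at h2
    rw [mem_opSq] at h3
    simp only [expd] at h2 h3
    have e : l = m := by
      apply Subtype.ext
      apply Prod.ext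
      · apply digit_eq <;> linarith
      · apply digit_eq <;> linarith
    subst e
    exact ih _ h hl

theorem carpet_approx (n : ℕ) : ∀ z ∈ sierpinskiCarpet, ∃ w, dist (cen w) z ≤ (1/3) ^ n := by
  induction n with
  | zero =>
    intro z hz
    refine ⟨[], ?_⟩
    have := carpet_subset hz
    rw [clSq, Metric.mem_closedBall, dist_comm] at this
    simp only [cen, pow_zero]
    linarith
  | succ n ih =>
    intro z hz
    obtain ⟨l, hl⟩ := carpet_tail z hz
    obtain ⟨w, hw⟩ := ih _ hl
    refine ⟨l :: w, ?_⟩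
    rw [dist_comm, dist_expd] at hw
    rw [dist_comm, pow_succ]
    linarith

theorem carpet_compl_dense : Dense (sierpinskiCarpetᶜ : Set Pl) := by
  intro z
  by_cases hz : z ∈ sierpinskiCarpet
  · rw [Metric.mem_closure_iff]
    intro ε hε
    obtain ⟨n, hn⟩ := exists_pow_lt_of_lt_one hε (show (1/3 : ℝ) < 1 by norm_num)
    obtain ⟨w, hw⟩ := carpet_approx n z hz
    exact ⟨cen w, ball_not_carpet w _ (Metric.mem_ball_self (rad_pos w)), by
      rw [dist_comm]; linarith⟩
  · exact subset_closure hz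

theorem good_step (z : Pl) (hz : z ∈ clSq ∧ ∀ w, z ∉ Metric.ball (cen w) (rad w)) :
    ∃ l : Let8, expd l z ∈ clSq ∧ ∀ w, expd l z ∉ Metric.ball (cen w) (rad w) := by
  obtain ⟨h1, h2⟩ := hz
  have key : ∀ t : ℝ, 0 ≤ t → t ≤ 1 → ∃ a : Fin 3, (0 ≤ 3 * t - ((a : ℕ) : ℝ) ∧
      3 * t - ((a : ℕ) : ℝ) ≤ 1) ∧ (a = 1 → 1/3 < t ∧ t < 2/3) := by
    intro t h0 h1
    rcases le_or_gt t (1/3) with h | h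
    · exact ⟨0, ⟨by simp; linarith, by simp; linarith⟩, by simp⟩
    rcases lt_or_ge t (2/3) with h' | h'
    · exact ⟨1, ⟨by simp; linarith, by simp; linarith⟩, fun _ => ⟨h, h'⟩⟩
    · refine ⟨2, ⟨?_, ?_⟩, fun h => absurd h (by decide)⟩ <;> norm_num <;> linarith
  rw [mem_clSq] at h1
  obtain ⟨a, ha1, ha2⟩ := key z.1 h1.1.1 h1.1.2
  obtain ⟨b, hb1, hb2⟩ := key z.2 h1.2.1 h1.2.2
  refine ⟨⟨(a, b), ?_⟩, ?_, ?_⟩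
  · intro h
    apply h2 []
    rw [mem_ball_nil]
    exact ⟨ha2 (congrArg Prod.fst h), hb2 (congrArg Prod.snd h)⟩
  · rw [mem_clSq]; exact ⟨ha1, hb1⟩
  · intro w hw
    exact h2 _ ((mem_ball_cons _ w z).2 hw)

theorem digits_of_orbit (a : ℕ → ℕ) (x : ℕ → ℝ) (hx : ∀ n, 0 ≤ x n ∧ x n ≤ 1)
    (h : ∀ n, x (n + 1) = 3 * x n - a n) : x 0 = ∑' i : ℕ, (a i : ℝ) / 3 ^ (i + 1) := by
  have hp : ∀ n, ∑ i ∈ Finset.range n, (a i : ℝ) / 3 ^ (i + 1) = x 0 - x n * (1/3) ^ n := by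
    intro n
    induction n with
    | zero => simp
    | succ n ih =>
      rw [Finset.sum_range_succ, ih, h n, one_div, inv_pow, inv_pow, pow_succ]
      field_simp
      ring
  have ht : HasSum (fun i => (a i : ℝ) / 3 ^ (i + 1)) (x 0) := by
    rw [hasSum_iff_tendsto_nat_of_nonneg (fun i => by positivity)]
    simp only [hp]
    have h0 : Tendsto (fun n : ℕ => (1/3 : ℝ) ^ n) atTop (𝓝 0) :=
      tendsto_pow_atTop_nhds_zero_of_lt_one (by norm_num) (by norm_num)
    have h1 : Tendsto (fun n : ℕ => x n * (1/3 : ℝ) ^ n) atTop (𝓝 0) := by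
      refine squeeze_zero (fun n => mul_nonneg (hx n).1 (by positivity)) (fun n => ?_) h0
      exact mul_le_of_le_one_left (by positivity) (hx n).2
    simpa using tendsto_const_nhds.sub h1
  exact ht.tsum_eq.symm

theorem carpet_cover (z : Pl) (hz : z ∈ clSq) (hw : ∀ w, z ∉ Metric.ball (cen w) (rad w)) :
    z ∈ sierpinskiCarpet := by
  let T := {z : Pl // z ∈ clSq ∧ ∀ w, z ∉ Metric.ball (cen w) (rad w)}
  choose L hL using fun t : T => good_step t.1 t.2
  let st : T → T := fun t => ⟨expd (L t) t.1, hL t⟩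
  let o : ℕ → T := fun n => st^[n] ⟨z, hz, hw⟩
  have ho : ∀ n, o (n + 1) = st (o n) := fun n => Function.iterate_succ_apply' _ _ _
  have hb : ∀ n, _ := fun n => (mem_clSq _).1 (o n).2.1
  refine ⟨fun n => (L (o n)).1.1, fun n => (L (o n)).1.2, fun n => Fin.is_lt _, fun n => Fin.is_lt _,
    ?_, ?_, ?_⟩
  · refine digits_of_orbit (fun n => (L (o n)).1.1) (fun n => (o n).1.1) (fun n => (hb n).1) ?_
    intro n
    simp only [ho, st, expd]
  · refine digits_of_orbit (fun n => (L (o n)).1.2) (fun n => (o n).1.2) (fun n => (hb n).2) ?_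
    intro n
    simp only [ho, st, expd]
  · rintro n ⟨h1, h2⟩
    exact (L (o n)).2 (Prod.ext (Fin.ext h1) (Fin.ext h2))

theorem carpet_eq : sierpinskiCarpet = clSq ∩ ⋂ w, (Metric.ball (cen w) (rad w))ᶜ := by
  ext z
  simp only [mem_inter_iff, mem_iInter, mem_compl_iff]
  exact ⟨fun h => ⟨carpet_subset h, fun w hw => ball_not_carpet w z hw h⟩,
    fun h => carpet_cover z h.1 h.2⟩

theorem carpet_compact : IsCompact (sierpinskiCarpet : Set Pl) := by
  rw [carpet_eq]
  exact (isCompact_closedBall _ _).inter_right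
    (isClosed_iInter fun w => Metric.isOpen_ball.isClosed_compl)

/-- The holes, closed; `none` is the outer one. -/
def hole : Option (List Let8) → Set Pl
  | none => opSqᶜ
  | some w => Metric.closedBall (cen w) (rad w)

/-- The open holes. -/
def ohole : Option (List Let8) → Set Pl
  | none => clSqᶜ
  | some w => Metric.ball (cen w) (rad w)

theorem hole_closed (i) : IsClosed (hole i) := by
  cases i
  · exact Metric.isOpen_ball.isClosed_compl
  · exact Metric.isClosed_closedBall

theorem ohole_open (i) : IsOpen (ohole i) := by
  cases i
  · exact Metric.isClosed_closedBall.isOpen_compl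
  · exact Metric.isOpen_ball

theorem ohole_subset (i) : ohole i ⊆ hole i := by
  cases i
  · exact compl_subset_compl.2 Metric.ball_subset_closedBall
  · exact Metric.ball_subset_closedBall

theorem hole_disj (i j x) (hi : x ∈ hole i) (hj : x ∈ hole j) : i = j := by
  cases i <;> cases j
  · rfl
  · exact (hi (cball_subset _ hj)).elim
  · exact (hj (cball_subset _ hi)).elim
  · rw [cball_disj _ _ x hi hj]

theorem hole_null (η : ℝ) (hη : 0 < η) : {i | ∃ x ∈ hole i, ∃ y ∈ hole i, η ≤ dist x y}.Finite := by
  refine (((null_fam η hη).image some).insert none).subset ?_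
  rintro (_ | w) h
  · exact Or.inl rfl
  · exact Or.inr ⟨w, h, rfl⟩

theorem frontier_subset_hole (x : Pl) (hx : x ∈ (sierpinskiCarpetᶜ : Set Pl)) :
    ∃ i, frontier (connectedComponentIn sierpinskiCarpetᶜ x) ⊆ hole i := by
  have hcov : ∀ z ∈ (sierpinskiCarpetᶜ : Set Pl), ∃ i, z ∈ ohole i := by
    intro z hz
    by_contra! h
    exact hz (carpet_cover z (not_not.1 (h none)) fun w => h (some w))
  obtain ⟨i, hi⟩ := hcov x hx
  refine ⟨i, ?_⟩
  have hsub : connectedComponentIn sierpinskiCarpetᶜ x ⊆ ohole i := by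
    refine isPreconnected_connectedComponentIn.subset_left_of_subset_union (ohole_open i)
      (isOpen_iUnion fun j => isOpen_iUnion fun (_ : j ≠ i) => ohole_open j) ?_ ?_
      ⟨x, mem_connectedComponentIn hx, hi⟩
    · rw [Set.disjoint_left]
      intro z hz hz'
      simp only [mem_iUnion] at hz'
      obtain ⟨j, hj, hzj⟩ := hz'
      exact hj (hole_disj j i z (ohole_subset j hzj) (ohole_subset i hz))
    · intro z hz
      obtain ⟨j, hj⟩ := hcov z (connectedComponentIn_subset _ _ hz)
      by_cases h : j = i
      · left; rw [← h]; exact hj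
      · right; simp only [mem_iUnion]; exact ⟨j, h, hj⟩
  exact frontier_subset_closure.trans
    (closure_minimal (hsub.trans (ohole_subset i)) (hole_closed i))

theorem translate_avoid (C : Set Pl) (hC : C.Countable) :
    ∃ t : Pl, dist t ((7/16, 7/16) : Pl) < 1/8 ∧
      ∀ z ∈ sierpinskiCarpet, t + (1/8 : ℝ) • z ∉ C := by
  have hd : Dense (⋂ d ∈ C, {t : Pl | (8 : ℝ) • (d - t) ∈ (sierpinskiCarpetᶜ : Set Pl)}) := by
    refine dense_biInter_of_isOpen (fun d _ => ?_) hC (fun d _ => ?_)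
    · exact carpet_compact.isClosed.isOpen_compl.preimage
        (by fun_prop : Continuous fun t : Pl => (8 : ℝ) • (d - t))
    · have hh : IsOpenMap fun t : Pl => (8 : ℝ) • (d - t) :=
        (isOpenMap_smul₀ (by norm_num : (8 : ℝ) ≠ 0)).comp (Homeomorph.subLeft d).isOpenMap
      exact carpet_compl_dense.preimage hh
  obtain ⟨t, ht, htd⟩ := Metric.dense_iff.1 hd (7/16, 7/16) (1/8) (by norm_num)
  refine ⟨t, ht, fun z hz hzC => ?_⟩
  have h1 := mem_iInter₂.1 htd _ hzC
  have h2 : (8 : ℝ) • (t + (1/8 : ℝ) • z - t) = z := by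
    rw [add_sub_cancel_left, smul_smul]; norm_num
  rw [mem_ofPred_eq, h2] at h1
  exact h1 hz

theorem carpet_main :
    ∃ S' : Set Pl, S' ⊆ sierpinskiCarpet ∧
      Nonempty (↥S' ≃ₜ ↥sierpinskiCarpet) ∧ ∀ i, Disjoint S' (hole i) := by
  obtain ⟨Y, _, _, π, hπ, hπs, hπe⟩ := quot_exists hole hole_closed hole_disj hole_null clSq
    (isCompact_closedBall _ _) (by
      intro x
      by_cases hx : x ∈ clSq
      · exact ⟨x, hx, Or.inl rfl⟩
      · refine ⟨(0, 0), (mem_clSq _).2 (by norm_num), Or.inr ⟨none, ohole_subset none hx, ?_⟩⟩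
        intro h
        have := ((mem_opSq _).1 h).1.1
        simp at this)
  have hDU : Metric.closedBall ((1/2, 1/2) : Pl) (1/4) ⊆ opSq :=
    Metric.closedBall_subset_ball (by norm_num)
  obtain ⟨f, hf, hfi⟩ := exists_injective_map cen rad rad_pos cball_disj null_fam opSq
    Metric.isOpen_ball Metric.isBounded_ball cball_subset π hπ (by
      intro x y h
      rcases (hπe x y).1 h with h | ⟨i, h1, h2⟩
      · exact Or.inl h
      · cases i with
        | none => exact Or.inr (Or.inl ⟨h1, h2⟩)
        | some w => exact Or.inr (Or.inr ⟨w, h1, h2⟩))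
    (fun w x hx => (hπe _ _).2 (Or.inr ⟨some w, hx,
      Metric.mem_closedBall_self (rad_pos w).le⟩))
    (Metric.closedBall ((1/2, 1/2) : Pl) (1/4)) (isCompact_closedBall _ _) hDU
  have hsub : ∀ i, (π '' hole i).Subsingleton := by
    rintro i _ ⟨x, hx, rfl⟩ _ ⟨y, hy, rfl⟩
    exact (hπe _ _).2 (Or.inr ⟨i, hx, hy⟩)
  have hC : (⋃ i, f ⁻¹' (π '' hole i)).Countable :=
    countable_iUnion fun i => ((hsub i).preimage hfi).countable
  obtain ⟨t, ht, hta⟩ := translate_avoid _ (hC.image (Subtype.val))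
  have hmem : ∀ z : sierpinskiCarpet, t + (1/8 : ℝ) • (z : Pl) ∈
      Metric.closedBall ((1/2, 1/2) : Pl) (1/4) := by
    intro z
    have h1 := (mem_clSq _).1 (carpet_subset z.2)
    simp only [Prod.dist_eq, max_lt_iff, Real.dist_eq, abs_lt] at ht
    simp only [Metric.mem_closedBall, Prod.dist_eq, max_le_iff, Real.dist_eq, abs_le,
      Prod.fst_add, Prod.snd_add, Prod.smul_fst, Prod.smul_snd, smul_eq_mul]
    refine ⟨⟨?_, ?_⟩, ?_, ?_⟩ <;> linarith
  let φ : sierpinskiCarpet → Y := fun z => f ⟨_, hmem z⟩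
  have hφ : Continuous φ := hf.comp (by fun_prop)
  have hφi : Function.Injective φ := by
    intro z z' h
    have h1 := congrArg Subtype.val (hfi h)
    simp only [add_right_inj] at h1
    exact Subtype.ext (smul_right_injective Pl (by norm_num : (1/8 : ℝ) ≠ 0) h1)
  have hφh : ∀ z i x, x ∈ hole i → φ z ≠ π x := by
    intro z i x hx h
    exact hta z z.2 ⟨⟨_, hmem z⟩, mem_iUnion.2 ⟨i, x, hx, h.symm⟩, rfl⟩
  have : CompactSpace sierpinskiCarpet := isCompact_iff_compactSpace.1 carpet_compact
  have hSd : ∀ i, Disjoint (π ⁻¹' range φ) (hole i) := by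
    intro i
    rw [Set.disjoint_left]
    rintro x ⟨z, hz⟩ hx
    exact hφh z i x hx hz
  have hSo : π ⁻¹' range φ ⊆ opSq := fun x hx => by
    by_contra h
    exact Set.disjoint_left.1 (hSd none) hx h
  have hSc : IsCompact (π ⁻¹' range φ) :=
    Metric.isCompact_of_isClosed_isBounded ((isCompact_range hφ).isClosed.preimage hπ)
      (Metric.isBounded_ball.subset hSo)
  have : CompactSpace (π ⁻¹' range φ) := isCompact_iff_compactSpace.1 hSc
  let ψ : π ⁻¹' range φ → Y := fun x => π x
  have hψ : Continuous ψ := by fun_prop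
  have hψi : Function.Injective ψ := by
    intro x y h
    rcases (hπe _ _).1 h with h | ⟨i, h1, -⟩
    · exact Subtype.ext h
    · exact (Set.disjoint_left.1 (hSd i) x.2 h1).elim
  have hr : range ψ = range φ := by
    apply Subset.antisymm
    · rintro _ ⟨x, rfl⟩; exact x.2
    · rintro y hy
      obtain ⟨x, rfl⟩ := hπs y
      exact ⟨⟨x, hy⟩, rfl⟩
  refine ⟨π ⁻¹' range φ, fun x hx => ?_, ⟨?_⟩, hSd⟩
  · refine carpet_cover x (Metric.ball_subset_closedBall (hSo hx)) fun w hw => ?_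
    exact Set.disjoint_left.1 (hSd (some w)) hx (Metric.ball_subset_closedBall hw)
  · exact ((hψ.isClosedEmbedding hψi).isEmbedding.toHomeomorph.trans
      (Homeomorph.setCongr hr)).trans (hφ.isClosedEmbedding hφi).isEmbedding.toHomeomorph.symm

/-- **Lemma 7.2.**
The Sierpiński carpet contains an embedded Sierpiński carpet that is disjoint from all of its
peripheral circles (the frontiers of the connected components of the complement of the
carpet in `ℝ²`). -/
theorem carpet_in_carpet_avoiding_peripheral_circles :
    ∃ S' : Set (ℝ × ℝ), S' ⊆ sierpinskiCarpet ∧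
      Nonempty (↥S' ≃ₜ ↥sierpinskiCarpet) ∧
      ∀ x ∈ (sierpinskiCarpetᶜ : Set (ℝ × ℝ)),
        Disjoint S' (frontier (connectedComponentIn sierpinskiCarpetᶜ x)) := by
  obtain ⟨S, h1, h2, h3⟩ := carpet_main
  refine ⟨S, h1, h2, fun x hx => ?_⟩
  obtain ⟨i, hi⟩ := frontier_subset_hole x hx
  exact (h3 i).mono_right hi
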